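/- Under the Hermite-spectral Vlasov–Poisson system, the weighted L² norm is globally stable: for all t ≥ 0, Σ_{n=0}^{N_H−1} α(t) ∫₀ᴸ C_n(t,x)² dx ≤ e^{t/(2γ)} Σ_{n=0}^{N_H−1} α(0) ∫₀ᴸ C_n(0,x)² dx; equivalently ‖f_{N_H}(t)‖_{ω(t)} ≤ ‖f_{N_H}(0)‖_{ω(0)} e^{t/(4γ)}, where ‖f_{N_H}(t)‖²_{ω(t)} := Σ_{n=0}^{N_H−1} α(t) ∫₀ᴸ C_n(t,x)² dx. -/

import Mathlib

open MeasureTheory Real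

section PartialDerivatives

variable {f : ℝ → ℝ → ℝ}

/-- The partial derivative in the first variable of a `C¹` function of two variables. -/
theorem hasDerivAt_fst_of_contDiff (hf : ContDiff ℝ 1 (fun p : ℝ × ℝ => f p.1 p.2)) (t x : ℝ) :
    HasDerivAt (fun τ => f τ x) (fderiv ℝ (fun p : ℝ × ℝ => f p.1 p.2) (t, x) (1, 0)) t := by
  have h := ((hf.differentiable one_ne_zero) (t, x)).hasFDerivAt
  exact h.comp_hasDerivAt t ((hasDerivAt_id t).prodMk (hasDerivAt_const t x))

/-- The partial derivative in the second variable of a `C¹` function of two variables. -/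
theorem hasDerivAt_snd_of_contDiff (hf : ContDiff ℝ 1 (fun p : ℝ × ℝ => f p.1 p.2)) (t x : ℝ) :
    HasDerivAt (fun y => f t y) (fderiv ℝ (fun p : ℝ × ℝ => f p.1 p.2) (t, x) (0, 1)) x := by
  have h := ((hf.differentiable one_ne_zero) (t, x)).hasFDerivAt
  exact h.comp_hasDerivAt x ((hasDerivAt_const x t).prodMk (hasDerivAt_id x))

theorem continuous_deriv_fst_of_contDiff (hf : ContDiff ℝ 1 (fun p : ℝ × ℝ => f p.1 p.2)) :
    Continuous (fun p : ℝ × ℝ => deriv (fun τ => f τ p.2) p.1) := by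
  simp_rw [fun p : ℝ × ℝ => (hasDerivAt_fst_of_contDiff hf p.1 p.2).deriv]
  exact (hf.continuous_fderiv one_ne_zero).clm_apply continuous_const

theorem continuous_deriv_snd_of_contDiff (hf : ContDiff ℝ 1 (fun p : ℝ × ℝ => f p.1 p.2)) :
    Continuous (fun p : ℝ × ℝ => deriv (fun y => f p.1 y) p.2) := by
  simp_rw [fun p : ℝ × ℝ => (hasDerivAt_snd_of_contDiff hf p.1 p.2).deriv]
  exact (hf.continuous_fderiv one_ne_zero).clm_apply continuous_const

/-- Differentiation under the integral sign for a `C¹` integrand on a bounded interval. -/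
theorem hasDerivAt_intervalIntegral_of_contDiff
    (hf : ContDiff ℝ 1 (fun p : ℝ × ℝ => f p.1 p.2)) (a b t : ℝ) :
    HasDerivAt (fun τ => ∫ x in a..b, f τ x) (∫ x in a..b, deriv (fun τ => f τ x) t) t := by
  have hcont := continuous_deriv_fst_of_contDiff hf
  obtain ⟨M, hM⟩ := ((isCompact_Icc (a := t - 1) (b := t + 1)).prod
    (isCompact_uIcc (a := a) (b := b))).exists_bound_of_continuousOn hcont.continuousOn
  have hslice : ∀ τ, Continuous (f τ) := fun τ => hf.continuous.comp (Continuous.prodMk_right τ)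
  refine (intervalIntegral.hasDerivAt_integral_of_dominated_loc_of_deriv_le
    (F' := fun τ x => deriv (fun τ => f τ x) τ) (bound := fun _ => M)
    (s := Set.Icc (t - 1) (t + 1)) (Icc_mem_nhds (by linarith) (by linarith))
    (.of_forall fun τ => (hslice τ).aestronglyMeasurable)
    ((hslice t).intervalIntegrable a b)
    (hcont.comp (Continuous.prodMk_right t)).aestronglyMeasurable
    (.of_forall fun x hx τ hτ => hM (τ, x) ⟨hτ, Set.uIoc_subset_uIcc hx⟩)
    intervalIntegrable_const
    (.of_forall fun x _ τ _ => ?_)).2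
  exact (hasDerivAt_fst_of_contDiff hf τ x).differentiableAt.hasDerivAt

end PartialDerivatives

/-- The derivative of a product of two `C¹` periodic functions integrates to zero over a period. -/
theorem integral_deriv_mul_eq_zero_of_periodic {u v u' v' : ℝ → ℝ} {L : ℝ}
    (hu : ∀ x, HasDerivAt u (u' x) x) (hv : ∀ x, HasDerivAt v (v' x) x)
    (hu' : Continuous u') (hv' : Continuous v')
    (hup : ∀ x, u (x + L) = u x) (hvp : ∀ x, v (x + L) = v x) :
    ∫ x in (0 : ℝ)..L, (u x * v' x + u' x * v x) = 0 := by
  have h := intervalIntegral.integral_deriv_mul_eq_sub (a := 0) (b := L)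
    (fun x _ => hu x) (fun x _ => hv x) (hu'.intervalIntegrable _ _) (hv'.intervalIntegrable _ _)
  have hu0 := hup 0
  have hv0 := hvp 0
  rw [zero_add] at hu0 hv0
  rw [hu0, hv0, sub_self] at h
  simpa only [add_comm] using h

/-- Young's inequality in the form that absorbs the electric field into the decay of the scaling. -/
theorem scaling_young_inequality {a γ S e c D : ℝ} (ha : 0 < a) (hγ : 0 < γ) (he : |e| ≤ S) :
    -(γ / 2) * S ^ 2 * a ^ 3 * D ^ 2 + a ^ 2 * e * c * D ≤ a / (2 * γ) * c ^ 2 := by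
  have he2 : e ^ 2 ≤ S ^ 2 := sq_le_sq' (abs_le.mp he).1 (abs_le.mp he).2
  have h1 : γ / 2 * e ^ 2 * a ^ 3 * D ^ 2 ≤ γ / 2 * S ^ 2 * a ^ 3 * D ^ 2 := by gcongr
  have h2 : a / (2 * γ) * c ^ 2 - a ^ 2 * e * c * D + γ / 2 * e ^ 2 * a ^ 3 * D ^ 2
      = a / (2 * γ) * (c - γ * a * e * D) ^ 2 := by
    field_simp
    ring
  have h3 : 0 ≤ a / (2 * γ) * (c - γ * a * e * D) ^ 2 := by positivity
  linarith

/-- The pointwise energy inequality: up to a sum of exact `x`-derivatives, the time derivative of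
`∑ a cₙ²` is controlled by `∑ a cₙ² / (2γ)`. Here `v` and `d` stand for the time and space
derivatives of `c`. -/
theorem hermite_energy_density_le {N : ℕ} {c d v : ℤ → ℝ} {a a' e S γ : ℝ}
    (ha : 0 < a) (hγ : 0 < γ) (he : |e| ≤ S) (ha' : a' = -(γ / 2) * S ^ 2 * a ^ 3)
    (hcN : c N = 0)
    (hv : ∀ n : ℕ, n < N →
      v n - (a' / a) * ((n : ℝ) * c n + √(((n : ℝ) - 1) * (n : ℝ)) * c (n - 2))
        + (1 / a) * (√(n : ℝ) * d (n - 1) + √((n : ℝ) + 1) * d (n + 1))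
        - a * √(n : ℝ) * e * c (n - 1) = 0) :
    ∑ n ∈ Finset.range N, (a' * c n ^ 2 + a * (2 * c n * v n)) ≤
      ∑ n ∈ Finset.range N, (a / (2 * γ) * c n ^ 2
        - 2 * √((n : ℝ) + 1) * (c n * d (n + 1) + d n * c (n + 1))) := by
  set W : ℕ → ℝ := fun n =>
    a' * (n * c n ^ 2 - n * c (n - 1) ^ 2 + 2 * √(((n : ℝ) - 1) * (n : ℝ)) * c n * c (n - 2))
      + a ^ 2 * e * √(n : ℝ) * c (n - 1) * c n - 2 * √(n : ℝ) * d (n - 1) * c n with hW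
  have hterm : ∀ n ∈ Finset.range N, a' * c n ^ 2 + a * (2 * c n * v n) ≤
      (a / (2 * γ) * c n ^ 2 - 2 * √((n : ℝ) + 1) * (c n * d (n + 1) + d n * c (n + 1)))
        - (W (n + 1) - W n) := by
    intro n hn
    have hvn : a * v n = a' * ((n : ℝ) * c n + √(((n : ℝ) - 1) * (n : ℝ)) * c (n - 2))
        - (√(n : ℝ) * d (n - 1) + √((n : ℝ) + 1) * d (n + 1))
        + a ^ 2 * √(n : ℝ) * e * c (n - 1) := by
      have h := hv n (Finset.mem_range.mp hn)
      have h1 : a * (a' / a) = a' := mul_div_cancel₀ a' ha.ne'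
      have h2 : a * (1 / a) = 1 := mul_one_div_cancel ha.ne'
      linear_combination a * h + ((n : ℝ) * c n + √(((n : ℝ) - 1) * (n : ℝ)) * c (n - 2)) * h1
        - (√(n : ℝ) * d (n - 1) + √((n : ℝ) + 1) * d (n + 1)) * h2
    have hy := scaling_young_inequality (c := c n)
      (D := √((n : ℝ) + 1) * c (n + 1) + √(n : ℝ) * c (n - 1)) ha hγ he
    rw [← ha'] at hy
    have hs : √((n : ℝ) * (n + 1)) = √(n : ℝ) * √((n : ℝ) + 1) := sqrt_mul n.cast_nonneg _
    have hs1 : √(n : ℝ) ^ 2 = n := sq_sqrt n.cast_nonneg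
    have hs2 : √((n : ℝ) + 1) ^ 2 = n + 1 := sq_sqrt (by positivity)
    have hi : (n : ℤ) + 1 - 2 = n - 1 := by ring
    simp only [hW, Nat.cast_add, Nat.cast_one, add_sub_cancel_right, hs, hi]
    linear_combination hy + 2 * c n * hvn - a' * c (n + 1) ^ 2 * hs2 - a' * c (n - 1) ^ 2 * hs1
  have hW0 : W 0 = 0 := by simp [hW]
  have hWN : 0 ≤ W N := by
    have hS : 0 ≤ S := (abs_nonneg e).trans he
    simp only [hW, hcN]
    have : 0 ≤ γ / 2 * S ^ 2 * a ^ 3 * (N * c (N - 1) ^ 2) := by positivity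
    rw [ha']
    linarith
  refine (Finset.sum_le_sum hterm).trans ?_
  rw [Finset.sum_sub_distrib, Finset.sum_range_sub, hW0]
  linarith

/-- Grönwall's inequality in differential form, with a constant rate. -/
theorem le_exp_mul_of_hasDerivAt_le {y y' : ℝ → ℝ} {k : ℝ}
    (hy : ∀ t, 0 ≤ t → HasDerivAt y (y' t) t) (hle : ∀ t, 0 ≤ t → y' t ≤ k * y t)
    {t : ℝ} (ht : 0 ≤ t) : y t ≤ exp (k * t) * y 0 := by
  have hd : ∀ s, 0 ≤ s → HasDerivAt (fun s => exp (-(k * s)) * y s)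
      (exp (-(k * s)) * (y' s - k * y s)) s := by
    intro s hs
    have h := (((hasDerivAt_id s).const_mul k).neg.exp).mul (hy s hs)
    refine h.congr_deriv ?_
    simp only [id, Pi.neg_apply]
    ring
  have hanti : AntitoneOn (fun s => exp (-(k * s)) * y s) (Set.Ici 0) := by
    refine antitoneOn_of_deriv_nonpos (convex_Ici 0)
      (fun s hs => (hd s hs).continuousAt.continuousWithinAt) ?_ ?_
    · intro s hs
      exact (hd s (interior_subset hs)).differentiableAt.differentiableWithinAt
    · intro s hs
      have hs' : 0 ≤ s := interior_subset hs
      rw [(hd s hs').deriv]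
      exact mul_nonpos_of_nonneg_of_nonpos (exp_nonneg _) (sub_nonpos.mpr (hle s hs'))
  have h := hanti Set.self_mem_Ici ht ht
  simp only [mul_zero, neg_zero, exp_zero, one_mul] at h
  rwa [exp_neg, inv_mul_le_iff₀ (exp_pos _)] at h



/-- Global weighted L² stability for the Hermite-spectral Vlasov–Poisson system:
`‖f_{N_H}(t)‖²_{ω(t)} = Σₙ α(t) ∫₀ᴸ Cₙ(t,x)² dx ≤ e^{t/(2γ)} ‖f_{N_H}(0)‖²_{ω(0)}`. -/
theorem hermite_weighted_L2_stability
    (N_H : ℕ) (hNH : 3 ≤ N_H)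
    (L α₀ γ ρ₀ : ℝ) (hL : 0 < L) (hα₀ : 0 < α₀) (hγ : 0 < γ)
    (C : ℤ → ℝ → ℝ → ℝ) (Φ E : ℝ → ℝ → ℝ) (α αd Esup : ℝ → ℝ)
    -- the Cₙ are C¹ and L-periodic in x, with Cₙ ≡ 0 for n < 0 and n ≥ N_H
    (hC1 : ∀ n : ℤ, ContDiff ℝ 1 (fun p : ℝ × ℝ => C n p.1 p.2))
    (hCper : ∀ (n : ℤ) (t x : ℝ), C n t (x + L) = C n t x)
    (hCneg : ∀ n : ℤ, n < 0 → C n = 0)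
    (hCbig : ∀ n : ℤ, (N_H : ℤ) ≤ n → C n = 0)
    -- Φ, E are C¹ and L-periodic in x, with E = -∂ₓΦ and ∂ₓE = C₀ - ρ₀
    (hΦ1 : ContDiff ℝ 1 (fun p : ℝ × ℝ => Φ p.1 p.2))
    (hE1 : ContDiff ℝ 1 (fun p : ℝ × ℝ => E p.1 p.2))
    (hΦper : ∀ t x : ℝ, Φ t (x + L) = Φ t x)
    (hEper : ∀ t x : ℝ, E t (x + L) = E t x)
    (hEΦ : ∀ t x : ℝ, E t x = - deriv (fun y => Φ t y) x)
    (hPoisson : ∀ t x : ℝ, deriv (fun y => E t y) x = C 0 t x - ρ₀)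
    -- the sup norm in x of E, assumed continuous in t
    (hEsup : ∀ t, Esup t = ⨆ x : ℝ, |E t x|)
    (hEbdd : ∀ t, BddAbove (Set.range fun x : ℝ => |E t x|))
    (hEsupCont : Continuous Esup)
    -- the scaling function α and its derivative α' = -(γ/2) ‖E‖_∞² α³
    (hα : ∀ t, α t = α₀ / Real.sqrt (1 + γ * ∫ s in (0:ℝ)..t, (Esup s) ^ 2))
    (hαd : ∀ t, αd t = -(γ / 2) * (Esup t) ^ 2 * (α t) ^ 3)
    (hαderiv : ∀ t, 0 ≤ t → HasDerivAt α (αd t) t)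
    -- the Hermite-spectral Vlasov system
    (hVlasov : ∀ n : ℤ, 0 ≤ n → n < (N_H : ℤ) → ∀ t x : ℝ, 0 ≤ t →
      deriv (fun τ => C n τ x) t
        - (αd t / α t) * ((n : ℝ) * C n t x + Real.sqrt (((n : ℝ) - 1) * (n : ℝ)) * C (n - 2) t x)
        + (1 / α t) * (Real.sqrt (n : ℝ) * deriv (fun y => C (n - 1) t y) x
            + Real.sqrt ((n : ℝ) + 1) * deriv (fun y => C (n + 1) t y) x)
        - α t * Real.sqrt (n : ℝ) * E t x * C (n - 1) t x = 0) :
    ∀ t, 0 ≤ t →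
      ∑ n ∈ Finset.range N_H, α t * ∫ x in (0:ℝ)..L, (C n t x) ^ 2
        ≤ Real.exp (t / (2 * γ)) *
          ∑ n ∈ Finset.range N_H, α 0 * ∫ x in (0:ℝ)..L, (C n 0 x) ^ 2 := by
  have hαpos : ∀ t, 0 ≤ t → 0 < α t := by
    intro t ht
    have hI : 0 ≤ ∫ s in (0:ℝ)..t, (Esup s) ^ 2 :=
      intervalIntegral.integral_nonneg ht fun s _ => sq_nonneg _
    rw [hα]
    positivity
  have hdt : ∀ n t x, HasDerivAt (fun τ => C n τ x) (deriv (fun τ => C n τ x) t) t := fun n t x =>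
    (hasDerivAt_fst_of_contDiff (hC1 n) t x).differentiableAt.hasDerivAt
  have hdx : ∀ n t x, HasDerivAt (fun y => C n t y) (deriv (fun y => C n t y) x) x := fun n t x =>
    (hasDerivAt_snd_of_contDiff (hC1 n) t x).differentiableAt.hasDerivAt
  have hcC : ∀ n t, Continuous (C n t) := fun n t =>
    (hC1 n).continuous.comp (Continuous.prodMk_right t)
  have hcdt : ∀ n t, Continuous (fun x => deriv (fun τ => C n τ x) t) := fun n t =>
    (continuous_deriv_fst_of_contDiff (hC1 n)).comp (Continuous.prodMk_right t)
  have hcdx : ∀ n t, Continuous (fun x => deriv (fun y => C n t y) x) := fun n t =>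
    (continuous_deriv_snd_of_contDiff (hC1 n)).comp (Continuous.prodMk_right t)
  have hnorm : ∀ (n : ℤ) t, HasDerivAt (fun τ => ∫ x in (0:ℝ)..L, (C n τ x) ^ 2)
      (∫ x in (0:ℝ)..L, 2 * C n t x * deriv (fun τ => C n τ x) t) t := by
    intro n t
    refine (hasDerivAt_intervalIntegral_of_contDiff (f := fun τ x => (C n τ x) ^ 2)
      ((hC1 n).pow 2) 0 L t).congr_deriv ?_
    congr 1 with x
    simpa using ((hdt n t x).fun_pow 2).deriv
  have henergy : ∀ t, 0 ≤ t →
      HasDerivAt (fun τ => ∑ n ∈ Finset.range N_H, α τ * ∫ x in (0:ℝ)..L, (C n τ x) ^ 2)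
        (∑ n ∈ Finset.range N_H, (αd t * (∫ x in (0:ℝ)..L, (C n t x) ^ 2)
          + α t * ∫ x in (0:ℝ)..L, 2 * C n t x * deriv (fun τ => C n τ x) t)) t := fun t ht =>
    HasDerivAt.fun_sum fun n _ => (hαderiv t ht).mul (hnorm n t)
  have hrate : ∀ t, 0 ≤ t →
      ∑ n ∈ Finset.range N_H, (αd t * (∫ x in (0:ℝ)..L, (C n t x) ^ 2)
          + α t * ∫ x in (0:ℝ)..L, 2 * C n t x * deriv (fun τ => C n τ x) t)
        ≤ 1 / (2 * γ) * ∑ n ∈ Finset.range N_H, α t * ∫ x in (0:ℝ)..L, (C n t x) ^ 2 := by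
    intro t ht
    have hcsq : ∀ n : ℤ, Continuous fun x => (C n t x) ^ 2 := fun n => (hcC n t).pow 2
    have hcprod : ∀ n : ℤ, Continuous fun x => 2 * C n t x * deriv (fun τ => C n τ x) t :=
      fun n => (continuous_const.mul (hcC n t)).mul (hcdt n t)
    have hcflux : ∀ n : ℤ, Continuous fun x => C n t x * deriv (fun y => C (n + 1) t y) x
        + deriv (fun y => C n t y) x * C (n + 1) t x := fun n =>
      ((hcC n t).mul (hcdx (n + 1) t)).add ((hcdx n t).mul (hcC (n + 1) t))
    have hcL : ∀ n : ℕ, Continuous fun x => αd t * (C n t x) ^ 2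
        + α t * (2 * C n t x * deriv (fun τ => C n τ x) t) := fun n =>
      ((hcsq n).const_mul _).add ((hcprod n).const_mul _)
    have hcR : ∀ n : ℕ, Continuous fun x => α t / (2 * γ) * (C n t x) ^ 2
        - 2 * √((n : ℝ) + 1) * (C n t x * deriv (fun y => C (n + 1) t y) x
          + deriv (fun y => C n t y) x * C (n + 1) t x) := fun n =>
      ((hcsq n).const_mul _).sub ((hcflux n).const_mul _)
    have hlhs : ∑ n ∈ Finset.range N_H, (αd t * (∫ x in (0:ℝ)..L, (C n t x) ^ 2)
          + α t * ∫ x in (0:ℝ)..L, 2 * C n t x * deriv (fun τ => C n τ x) t)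
        = ∫ x in (0:ℝ)..L, ∑ n ∈ Finset.range N_H, (αd t * (C n t x) ^ 2
          + α t * (2 * C n t x * deriv (fun τ => C n τ x) t)) := by
      rw [intervalIntegral.integral_finsetSum fun n _ => (hcL n).intervalIntegrable 0 L]
      refine Finset.sum_congr rfl fun n _ => ?_
      rw [intervalIntegral.integral_add (((hcsq n).const_mul _).intervalIntegrable 0 L)
        (((hcprod n).const_mul _).intervalIntegrable 0 L), intervalIntegral.integral_const_mul,
        intervalIntegral.integral_const_mul]
    have hrhs : 1 / (2 * γ) * ∑ n ∈ Finset.range N_H, α t * ∫ x in (0:ℝ)..L, (C n t x) ^ 2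
        = ∫ x in (0:ℝ)..L, ∑ n ∈ Finset.range N_H, (α t / (2 * γ) * (C n t x) ^ 2
          - 2 * √((n : ℝ) + 1) * (C n t x * deriv (fun y => C (n + 1) t y) x
            + deriv (fun y => C n t y) x * C (n + 1) t x)) := by
      rw [intervalIntegral.integral_finsetSum fun n _ => (hcR n).intervalIntegrable 0 L,
        Finset.mul_sum]
      refine Finset.sum_congr rfl fun n _ => ?_
      rw [intervalIntegral.integral_sub (((hcsq n).const_mul _).intervalIntegrable 0 L)
        (((hcflux n).const_mul _).intervalIntegrable 0 L), intervalIntegral.integral_const_mul,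
        intervalIntegral.integral_const_mul, integral_deriv_mul_eq_zero_of_periodic
          (hdx n t) (hdx (n + 1) t) (hcdx n t) (hcdx (n + 1) t) (hCper n t) (hCper (n + 1) t)]
      ring
    rw [hlhs, hrhs]
    refine intervalIntegral.integral_mono_on hL.le
      ((continuous_finsetSum _ fun n _ => hcL n).intervalIntegrable 0 L)
      ((continuous_finsetSum _ fun n _ => hcR n).intervalIntegrable 0 L)
      fun x _ => ?_
    refine hermite_energy_density_le (c := fun n => C n t x)
      (d := fun n => deriv (fun y => C n t y) x) (v := fun n => deriv (fun τ => C n τ x) t)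
      (e := E t x) (hαpos t ht) hγ ?_ (hαd t) ?_ ?_
    · rw [hEsup]
      exact le_ciSup (hEbdd t) x
    · simp [hCbig N_H le_rfl]
    · intro n hn
      simpa only [Int.cast_natCast] using
        hVlasov n (Int.natCast_nonneg n) (by exact_mod_cast hn) t x ht
  intro t ht
  have h := le_exp_mul_of_hasDerivAt_le henergy hrate ht
  rwa [one_div_mul_eq_div] at h
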